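/- For every integer N ≥ 1 and every A > 0 there exists a constant C = C(N,A) > 0 with the following property: if (λ_k)_{k≥1} is a sequence in 𝔻∖{0} with Σ_{k=1}^∞ (1−|λ_k|²)/|1−λ_k|^{2N} ≤ A, then for every n ≥ 1 the finite Blaschke product B_n(z) = ∏_{k=1}^n (|λ_k|/λ_k)·(λ_k−z)/(1−conj(λ_k)z) satisfies D₁^N(B_n) ≤ C·Σ_{k=1}^n (1−|λ_k|²)/|1−λ_k|^{2N}. -/

import Mathlib

open Complex MeasureTheory Metric Set Finset Filter Polynomial
open scoped ENNReal NNReal Topology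

noncomputable section

/-- Membership in the Hardy space `H²` of the unit disk. -/
def MemHardy2 (f : ℂ → ℂ) : Prop :=
  DifferentiableOn ℂ f (ball (0 : ℂ) 1) ∧
  ∃ C : ℝ, ∀ r : ℝ, 0 < r → r < 1 →
    (1 / (2 * Real.pi)) * ∫ t in (0 : ℝ)..(2 * Real.pi),
      ‖f ((r : ℂ) * Complex.exp ((t : ℂ) * Complex.I))‖ ^ 2 ≤ C

/-- The squared `H²` norm of `f`, as the supremum of the circle means. -/
def h2NormSq (f : ℂ → ℂ) : ℝ :=
  sSup {y : ℝ | ∃ r : ℝ, 0 < r ∧ r < 1 ∧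
    y = (1 / (2 * Real.pi)) * ∫ t in (0 : ℝ)..(2 * Real.pi),
      ‖f ((r : ℂ) * Complex.exp ((t : ℂ) * Complex.I))‖ ^ 2}

/-- The local Dirichlet integral of order `N` at the point `1`:
`D₁^N(h) = inf { ‖(h-q)/(z-1)^N‖²_{H²} : q polynomial, deg q < N, (h-q)/(z-1)^N ∈ H² }`,
with value `∞` if no such `q` exists. -/
def D1N (N : ℕ) (h : ℂ → ℂ) : ℝ≥0∞ :=
  ⨅ (q : Polynomial ℂ) (_ : q.degree < (N : ℕ) ∧
      MemHardy2 fun z => (h z - q.eval z) / (z - 1) ^ N),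
    ENNReal.ofReal (h2NormSq fun z => (h z - q.eval z) / (z - 1) ^ N)

/-- The mean of `‖f‖²` over the unit circle. -/
def sqMean (f : ℂ → ℂ) : ℝ := Real.circleAverage (fun z => ‖f z‖ ^ 2) 0 1

/-- The `L²` pairing of two functions over the unit circle. -/
def circlePairing (f g : ℂ → ℂ) : ℂ :=
  Real.circleAverage (fun z => f z * (starRingEnd ℂ) (g z)) 0 1

lemma intervalIntegral_swap_of_continuous {F : ℝ → ℝ → ℝ} (hF : Continuous (Function.uncurry F))
    {a b : ℝ} (hab : a ≤ b) :
    ∫ x in a..b, ∫ y in a..b, F x y = ∫ y in a..b, ∫ x in a..b, F x y := by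
  simp only [intervalIntegral.integral_of_le hab]
  apply integral_integral_swap
  rw [Measure.prod_restrict]
  have h : IntegrableOn (Function.uncurry F) (Icc a b ×ˢ Icc a b) (volume.prod volume) :=
    hF.continuousOn.integrableOn_compact (isCompact_Icc.prod isCompact_Icc)
  exact h.mono_set (prod_mono Ioc_subset_Icc_self Ioc_subset_Icc_self)

lemma DiffContOnCl.continuousOn_sphere {f : ℂ → ℂ} (hf : DiffContOnCl ℂ f (ball (0 : ℂ) 1)) :
    ContinuousOn f (sphere (0 : ℂ) 1) :=
  hf.continuousOn_ball.mono sphere_subset_closedBall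

lemma DiffContOnCl.fun_mul {f g : ℂ → ℂ} {s : Set ℂ} (hf : DiffContOnCl ℂ f s)
    (hg : DiffContOnCl ℂ g s) : DiffContOnCl ℂ (fun z => f z * g z) s :=
  hf.smul hg

lemma norm_sq_le_circleAverage_poissonKernel {f : ℂ → ℂ}
    (hf : DiffContOnCl ℂ f (ball (0 : ℂ) 1)) {w : ℂ} (hw : w ∈ ball (0 : ℂ) 1) :
    ‖f w‖ ^ 2 ≤ Real.circleAverage (fun z => poissonKernel 0 w z * ‖f z‖ ^ 2) 0 1 := by
  have h := (hf.smul hf).circleAverage_poissonKernel_smul hw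
  have hk : ∀ z ∈ sphere (0 : ℂ) 1, 0 ≤ poissonKernel 0 w z := by
    intro z hz
    rw [poissonKernel_def]
    have h1 : ‖z‖ = 1 := by simpa using hz
    have h2 : ‖w‖ < 1 := by simpa using hw
    have : ‖w‖ ^ 2 ≤ 1 := by nlinarith [norm_nonneg w]
    simp only [sub_zero, h1]
    apply div_nonneg <;> [linarith; positivity]
  have h2 : ‖f w‖ ^ 2 = ‖f w • f w‖ := by simp [sq]
  rw [h2, ← h, Real.circleAverage_def, Real.circleAverage_def, norm_smul, smul_eq_mul,
    Real.norm_of_nonneg (by positivity)]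
  gcongr
  refine (intervalIntegral.norm_integral_le_integral_norm (by positivity)).trans (le_of_eq ?_)
  congr 1
  ext t
  have := hk (circleMap 0 1 t) (circleMap_mem_sphere 0 zero_le_one t)
  simp [abs_of_nonneg this, sq]

/-- The circle means of `‖f‖²` at smaller radii are bounded by the mean over the unit circle. -/
lemma circleMean_le_sqMean {f : ℂ → ℂ} (hf : DiffContOnCl ℂ f (ball (0 : ℂ) 1))
    {r : ℝ} (hr0 : 0 < r) (hr : r < 1) :
    (1 / (2 * Real.pi)) * ∫ t in (0 : ℝ)..(2 * Real.pi),
      ‖f ((r : ℂ) * Complex.exp ((t : ℂ) * Complex.I))‖ ^ 2 ≤ sqMean f := by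
  have hrb : (r : ℂ) ∈ ball (0 : ℂ) 1 := by simpa [abs_of_pos hr0] using hr
  set k : ℝ → ℝ := fun θ => poissonKernel 0 (r : ℂ) (circleMap 0 1 θ) with hk
  have hkc : Continuous k := by
    simp only [hk, poissonKernel_def]
    refine Continuous.div (by fun_prop) (by fun_prop) fun θ h => ?_
    have h1 : circleMap 0 1 θ = r := by
      have : ‖circleMap 0 1 θ - 0 - ((r : ℂ) - 0)‖ = 0 := by simpa using h
      rw [norm_eq_zero] at this
      linear_combination this
    have h2 : ‖circleMap 0 1 θ‖ = 1 := by simp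
    rw [h1] at h2
    simp [abs_of_pos hr0] at h2
    linarith
  set F : ℝ → ℝ := fun t => ‖f (circleMap 0 1 t)‖ ^ 2 with hF
  have hFc : Continuous F := by
    have : Continuous fun t => f (circleMap 0 1 t) :=
      hf.continuousOn_sphere.comp_continuous (by fun_prop)
        (fun t => circleMap_mem_sphere 0 zero_le_one t)
    exact this.norm.pow 2
  have hFk : ∀ θ, ∫ t in (0 : ℝ)..(2 * Real.pi), F (t + θ) = 2 * Real.pi * sqMean f := by
    intro θ
    rw [sqMean, Real.circleAverage_eq_integral_add θ]
    simp only [hF, smul_eq_mul]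
    field_simp
  have hk1 : ∫ θ in (0 : ℝ)..(2 * Real.pi), k θ = 2 * Real.pi := by
    have h1 : DiffContOnCl ℂ (fun _ : ℂ => (1 : ℂ)) (ball (0 : ℂ) 1) := diffContOnCl_const
    have h2 := h1.circleAverage_poissonKernel_smul hrb
    rw [Real.circleAverage_def] at h2
    have h3 : ∀ t, (poissonKernel 0 (r : ℂ) • fun _ : ℂ => (1 : ℂ)) (circleMap 0 1 t)
        = ((k t : ℝ) : ℂ) := by intro t; simp [hk]
    simp only [h3] at h2
    rw [intervalIntegral.integral_ofReal, Complex.real_smul, ← Complex.ofReal_mul] at h2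
    have h4 := Complex.ofReal_eq_one.mp h2
    field_simp at h4
    exact h4
  have hpt : ∀ t : ℝ, ‖f ((r : ℂ) * Complex.exp ((t : ℂ) * Complex.I))‖ ^ 2
      ≤ (2 * Real.pi)⁻¹ * ∫ θ in (0 : ℝ)..(2 * Real.pi), k θ * F (t + θ) := by
    intro t
    have hrot : DiffContOnCl ℂ (fun z => f (z * Complex.exp ((t : ℂ) * Complex.I)))
        (ball (0 : ℂ) 1) := by
      refine hf.comp (g := fun z => z * Complex.exp ((t : ℂ) * Complex.I))
        (DifferentiableOn.diffContOnCl (by fun_prop)) fun z hz => ?_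
      simpa [Complex.norm_exp_ofReal_mul_I] using hz
    have := norm_sq_le_circleAverage_poissonKernel hrot hrb
    rw [Real.circleAverage_def, smul_eq_mul] at this
    convert this using 5 with θ
    simp only [hF, circleMap]
    congr 3
    push_cast
    simp only [zero_add, one_mul, ← Complex.exp_add]
    congr 1
    ring
  have hLc : Continuous fun t : ℝ => ‖f ((r : ℂ) * Complex.exp ((t : ℂ) * Complex.I))‖ ^ 2 := by
    have : Continuous fun t : ℝ => f ((r : ℂ) * Complex.exp ((t : ℂ) * Complex.I)) := by
      refine hf.continuousOn_ball.comp_continuous (by fun_prop) fun t => ?_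
      simpa [abs_of_pos hr0, Complex.norm_exp_ofReal_mul_I] using hr.le
    exact this.norm.pow 2
  have hswap : ∫ t in (0 : ℝ)..(2 * Real.pi), ∫ θ in (0 : ℝ)..(2 * Real.pi), k θ * F (t + θ)
      = 2 * Real.pi * (2 * Real.pi * sqMean f) := by
    rw [intervalIntegral_swap_of_continuous (by unfold Function.uncurry; fun_prop) (by positivity)]
    simp only [intervalIntegral.integral_const_mul, hFk, intervalIntegral.integral_mul_const, hk1]
  have hmono := intervalIntegral.integral_mono (μ := volume) (a := 0) (b := 2 * Real.pi) (by positivity)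
    (hLc.intervalIntegrable _ _) (Continuous.intervalIntegrable (by fun_prop) _ _)
    hpt
  rw [intervalIntegral.integral_const_mul, hswap] at hmono
  have hpi := Real.pi_pos
  calc _ ≤ (1 / (2 * Real.pi)) * ((2 * Real.pi)⁻¹ * (2 * Real.pi * (2 * Real.pi * sqMean f))) := by
        gcongr
    _ = sqMean f := by field_simp

section circle

variable {f g h : ℂ → ℂ}

lemma circleIntegrable_of_continuousOn {E : Type*} [NormedAddCommGroup E] {F : ℂ → E}
    (hF : ContinuousOn F (sphere (0 : ℂ) 1)) : CircleIntegrable F 0 1 :=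
  hF.circleIntegrable zero_le_one

lemma circleAverage_mono_of_continuousOn {F G : ℂ → ℝ} (hF : ContinuousOn F (sphere (0 : ℂ) 1))
    (hG : ContinuousOn G (sphere (0 : ℂ) 1)) (hle : ∀ z ∈ sphere (0 : ℂ) 1, F z ≤ G z) :
    Real.circleAverage F 0 1 ≤ Real.circleAverage G 0 1 :=
  Real.circleAverage_mono (circleIntegrable_of_continuousOn hF)
    (circleIntegrable_of_continuousOn hG) (by simpa using hle)

lemma circleAverage_congr_of_eqOn {E : Type*} [NormedAddCommGroup E] [NormedSpace ℝ E]
    {F G : ℂ → E} (hFG : Set.EqOn F G (sphere (0 : ℂ) 1)) :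
    Real.circleAverage F 0 1 = Real.circleAverage G 0 1 :=
  Real.circleAverage_congr_sphere (by simpa using hFG)

lemma continuousOn_norm_sq {S : Set ℂ} (hf : ContinuousOn f S) :
    ContinuousOn (fun z => ‖f z‖ ^ 2) S :=
  hf.norm.pow 2

lemma sqMean_nonneg (f : ℂ → ℂ) : 0 ≤ sqMean f :=
  Real.circleAverage_nonneg_of_nonneg fun _ _ => by positivity

lemma sqMean_const_mul (a : ℂ) (f : ℂ → ℂ) :
    sqMean (fun z => a * f z) = ‖a‖ ^ 2 * sqMean f := by
  simp only [sqMean, norm_mul, mul_pow]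
  exact Real.circleAverage_fun_smul (𝕜 := ℝ)

lemma sqMean_mul_of_norm_eq_one (hf : ∀ z ∈ sphere (0 : ℂ) 1, ‖f z‖ = 1) :
    sqMean (fun z => f z * g z) = sqMean g :=
  circleAverage_congr_of_eqOn fun z hz => by simp [hf z hz]

lemma circlePairing_const_mul (a : ℂ) :
    circlePairing f (fun z => a * g z) = (starRingEnd ℂ) a * circlePairing f g := by
  simp only [circlePairing, ← smul_eq_mul ((starRingEnd ℂ) a), ← Real.circleAverage_fun_smul]
  congr 1
  ext z
  simp only [map_mul, smul_eq_mul]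
  ring

lemma circlePairing_mul_mul (hf : ∀ z ∈ sphere (0 : ℂ) 1, ‖f z‖ = 1) :
    circlePairing (fun z => f z * g z) (fun z => f z * h z) = circlePairing g h := by
  refine circleAverage_congr_of_eqOn fun z hz => ?_
  have : f z * (starRingEnd ℂ) (f z) = 1 := by simp [Complex.mul_conj', hf z hz]
  simp only [map_mul]
  linear_combination (g z * (starRingEnd ℂ) (h z)) * this

lemma circlePairing_add (hf : ContinuousOn f (sphere (0 : ℂ) 1))
    (hg : ContinuousOn g (sphere (0 : ℂ) 1)) (hh : ContinuousOn h (sphere (0 : ℂ) 1)) :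
    circlePairing f (fun z => g z + h z) = circlePairing f g + circlePairing f h := by
  simp only [circlePairing]
  rw [← Real.circleAverage_fun_add]
  · simp only [map_add, mul_add]
  · exact circleIntegrable_of_continuousOn (hf.mul (Complex.continuous_conj.comp_continuousOn hg))
  · exact circleIntegrable_of_continuousOn (hf.mul (Complex.continuous_conj.comp_continuousOn hh))

lemma circlePairing_sum {ι : Type*} {s : Finset ι} {G : ι → ℂ → ℂ}
    (hf : ContinuousOn f (sphere (0 : ℂ) 1))
    (hG : ∀ i ∈ s, ContinuousOn (G i) (sphere (0 : ℂ) 1)) :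
    circlePairing f (fun z => ∑ i ∈ s, G i z) = ∑ i ∈ s, circlePairing f (G i) := by
  simp only [circlePairing]
  rw [← Real.circleAverage_fun_sum]
  · simp only [map_sum, Finset.mul_sum]
  · exact fun i hi => circleIntegrable_of_continuousOn
      (hf.mul (Complex.continuous_conj.comp_continuousOn (hG i hi)))

lemma sqMean_add_of_circlePairing_eq_zero (hf : ContinuousOn f (sphere (0 : ℂ) 1))
    (hg : ContinuousOn g (sphere (0 : ℂ) 1)) (hfg : circlePairing f g = 0) :
    sqMean (fun z => f z + g z) = sqMean f + sqMean g := by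
  have hc : ContinuousOn (fun z => f z * (starRingEnd ℂ) (g z)) (sphere (0 : ℂ) 1) :=
    hf.mul (Complex.continuous_conj.comp_continuousOn hg)
  have hre : Real.circleAverage (fun z => (f z * (starRingEnd ℂ) (g z)).re) 0 1 = 0 := by
    have := Complex.reCLM.circleAverage_comp_comm (circleIntegrable_of_continuousOn hc)
    rw [circlePairing] at hfg
    rw [hfg] at this
    simpa [Function.comp_def] using this
  have hre2 : Real.circleAverage (fun z => 2 * (f z * (starRingEnd ℂ) (g z)).re) 0 1 = 0 := by
    have := Real.circleAverage_fun_smul (𝕜 := ℝ) (a := (2 : ℝ)) (c := 0) (R := 1)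
      (f := fun z => (f z * (starRingEnd ℂ) (g z)).re)
    rw [hre] at this
    simpa using this
  have hcre : ContinuousOn (fun z => 2 * (f z * (starRingEnd ℂ) (g z)).re) (sphere (0 : ℂ) 1) :=
    continuousOn_const.mul (Complex.continuous_re.comp_continuousOn hc)
  have key : ∀ z, ‖f z + g z‖ ^ 2
      = ‖f z‖ ^ 2 + ‖g z‖ ^ 2 + 2 * (f z * (starRingEnd ℂ) (g z)).re := by
    intro z
    simp only [← Complex.normSq_eq_norm_sq, Complex.normSq_add]
  simp only [sqMean, key]
  rw [Real.circleAverage_fun_add (circleIntegrable_of_continuousOn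
      ((continuousOn_norm_sq hf).fun_add (continuousOn_norm_sq hg))) (circleIntegrable_of_continuousOn hcre), hre2,
    Real.circleAverage_fun_add (circleIntegrable_of_continuousOn (continuousOn_norm_sq hf))
      (circleIntegrable_of_continuousOn (continuousOn_norm_sq hg)), add_zero]

lemma sqMean_add_le (hf : ContinuousOn f (sphere (0 : ℂ) 1))
    (hg : ContinuousOn g (sphere (0 : ℂ) 1)) {s : ℝ} (hs : 0 < s) :
    sqMean (fun z => f z + g z) ≤ (1 + s) * sqMean f + (1 + s⁻¹) * sqMean g := by
  simp only [sqMean, ← smul_eq_mul (1 + s), ← smul_eq_mul (1 + s⁻¹),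
    ← Real.circleAverage_fun_smul]
  simp only [smul_eq_mul]
  have hF := continuousOn_const (c := 1 + s) |>.fun_mul (continuousOn_norm_sq hf)
  have hG := continuousOn_const (c := 1 + s⁻¹) |>.fun_mul (continuousOn_norm_sq hg)
  rw [← Real.circleAverage_fun_add (circleIntegrable_of_continuousOn hF)
    (circleIntegrable_of_continuousOn hG)]
  refine circleAverage_mono_of_continuousOn (continuousOn_norm_sq (hf.add hg)) (hF.add hG) fun z _ => ?_
  have h1 : ‖f z + g z‖ ^ 2 ≤ (‖f z‖ + ‖g z‖) ^ 2 := by gcongr; exact norm_add_le _ _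
  have h2 : 0 ≤ s⁻¹ * (s * ‖f z‖ - ‖g z‖) ^ 2 := by positivity
  have h3 : s⁻¹ * (s * ‖f z‖ - ‖g z‖) ^ 2
      = s * ‖f z‖ ^ 2 - 2 * ‖f z‖ * ‖g z‖ + s⁻¹ * ‖g z‖ ^ 2 := by
    field_simp
    ring
  nlinarith

lemma sqMean_sum_le {ι : Type*} {s : Finset ι} {G : ι → ℂ → ℂ}
    (hG : ∀ i ∈ s, ContinuousOn (G i) (sphere (0 : ℂ) 1)) :
    sqMean (fun z => ∑ i ∈ s, G i z) ≤ #s * ∑ i ∈ s, sqMean (G i) := by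
  simp only [sqMean]
  rw [← Real.circleAverage_fun_sum fun i hi =>
    circleIntegrable_of_continuousOn (continuousOn_norm_sq (hG i hi)), ← smul_eq_mul,
    ← Real.circleAverage_fun_smul]
  refine circleAverage_mono_of_continuousOn (continuousOn_norm_sq (continuousOn_finsetSum s hG))
    (continuousOn_const.mul (continuousOn_finsetSum s fun i hi => continuousOn_norm_sq (hG i hi)))
    fun z _ => ?_
  have h1 : ‖∑ i ∈ s, G i z‖ ^ 2 ≤ (∑ i ∈ s, ‖G i z‖) ^ 2 := by
    gcongr; exact norm_sum_le _ _
  exact h1.trans sq_sum_le_card_mul_sum_sq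

end circle

/-- The kernel `1 / (1 - conj a * z)`. -/
def szegoKernel (a z : ℂ) : ℂ := (1 - (starRingEnd ℂ) a * z)⁻¹

/-- A single Blaschke factor with zero `a`. -/
def blaschkeFactor (a z : ℂ) : ℂ :=
  ((‖a‖ : ℂ) / a) * ((a - z) / (1 - (starRingEnd ℂ) a * z))

/-- The common factor in the Taylor quotients of a Blaschke factor at `1`. -/
def blaschkeSlope (a : ℂ) : ℂ :=
  -((‖a‖ : ℂ) / a) * ((1 - a * (starRingEnd ℂ) a) / (1 - (starRingEnd ℂ) a))

/-- The Taylor quotients of a Blaschke factor at `1`: `(b - T_{m-1} b) / (z - 1)^m`. -/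
def blaschkeQuot (a : ℂ) : ℕ → ℂ → ℂ
  | 0 => blaschkeFactor a
  | m + 1 => fun z =>
      blaschkeSlope a * ((starRingEnd ℂ) a / (1 - (starRingEnd ℂ) a)) ^ m * szegoKernel a z

/-- The Taylor coefficients of a Blaschke factor at `1`. -/
def blaschkeCoeff (a : ℂ) (m : ℕ) : ℂ := blaschkeQuot a m 1

section factor

variable {a : ℂ}

lemma one_sub_conj_mul_ne_zero (ha : ‖a‖ < 1) {z : ℂ} (hz : z ∈ closedBall (0 : ℂ) 1) :
    1 - (starRingEnd ℂ) a * z ≠ 0 := by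
  intro h
  have h1 : (starRingEnd ℂ) a * z = 1 := (sub_eq_zero.mp h).symm
  have h2 : ‖a‖ * ‖z‖ = 1 := by simpa using congrArg norm h1
  have h3 : ‖z‖ ≤ 1 := by simpa using hz
  nlinarith [norm_nonneg a, norm_nonneg z]

lemma one_sub_conj_ne_zero (ha : ‖a‖ < 1) : 1 - (starRingEnd ℂ) a ≠ 0 := by
  simpa using one_sub_conj_mul_ne_zero ha (z := 1) (by simp)

lemma norm_one_sub_conj (a : ℂ) : ‖1 - (starRingEnd ℂ) a‖ = ‖1 - a‖ := by
  rw [← Complex.norm_conj (1 - a)]; simp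

lemma diffContOnCl_szegoKernel (ha : ‖a‖ < 1) : DiffContOnCl ℂ (szegoKernel a) (ball 0 1) := by
  refine DiffContOnCl.inv (f := fun z => 1 - (starRingEnd ℂ) a * z)
    (Differentiable.diffContOnCl (by fun_prop)) fun z hz => ?_
  exact one_sub_conj_mul_ne_zero ha (closure_ball_subset_closedBall hz)

lemma blaschkeFactor_eq (a z : ℂ) :
    blaschkeFactor a z = ((‖a‖ : ℂ) / a) * (a - z) * szegoKernel a z := by
  simp only [blaschkeFactor, szegoKernel, div_eq_mul_inv, mul_assoc]

lemma diffContOnCl_blaschkeFactor (ha : ‖a‖ < 1) :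
    DiffContOnCl ℂ (blaschkeFactor a) (ball 0 1) := by
  have h : DiffContOnCl ℂ (fun z => ((‖a‖ : ℂ) / a) * (a - z)) (ball 0 1) :=
    Differentiable.diffContOnCl (by fun_prop)
  convert h.smul (diffContOnCl_szegoKernel ha) using 1
  ext z
  exact blaschkeFactor_eq a z

lemma diffContOnCl_blaschkeQuot (ha : ‖a‖ < 1) (m : ℕ) :
    DiffContOnCl ℂ (blaschkeQuot a m) (ball 0 1) := by
  cases m with
  | zero => exact diffContOnCl_blaschkeFactor ha
  | succ m => exact (diffContOnCl_const (c := blaschkeSlope a *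
      ((starRingEnd ℂ) a / (1 - (starRingEnd ℂ) a)) ^ m)).smul (diffContOnCl_szegoKernel ha)

lemma norm_norm_div_self (ha : a ≠ 0) : ‖(‖a‖ : ℂ) / a‖ = 1 := by
  simp [ha]

lemma norm_blaschkeFactor (ha : ‖a‖ < 1) (ha0 : a ≠ 0) {z : ℂ} (hz : z ∈ sphere (0 : ℂ) 1) :
    ‖blaschkeFactor a z‖ = 1 := by
  have hne := one_sub_conj_mul_ne_zero ha (sphere_subset_closedBall hz)
  have hz1 : ‖z‖ = 1 := by simpa using hz
  have hzz : (starRingEnd ℂ) z * z = 1 := by simp [Complex.conj_mul', hz1]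
  have h : ‖1 - (starRingEnd ℂ) a * z‖ = ‖a - z‖ := by
    have : 1 - (starRingEnd ℂ) a * z = -((starRingEnd ℂ) (a - z) * z) := by
      simp only [map_sub]; linear_combination -hzz
    rw [this, norm_neg, norm_mul, Complex.norm_conj, hz1, mul_one]
  rw [blaschkeFactor, norm_mul, norm_norm_div_self ha0, norm_div, h, one_mul]
  exact div_self (h ▸ norm_ne_zero_iff.mpr hne)

lemma szegoKernel_sub (ha : ‖a‖ < 1) {z : ℂ} (hz : z ∈ closedBall (0 : ℂ) 1) :
    szegoKernel a z = szegoKernel a 1 +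
      (z - 1) * ((starRingEnd ℂ) a / (1 - (starRingEnd ℂ) a) * szegoKernel a z) := by
  have h1 := one_sub_conj_mul_ne_zero ha hz
  have h2 := one_sub_conj_ne_zero ha
  simp only [szegoKernel, mul_one]
  field_simp
  ring

lemma blaschkeQuot_eq (ha : ‖a‖ < 1) (ha0 : a ≠ 0) (m : ℕ) {z : ℂ}
    (hz : z ∈ closedBall (0 : ℂ) 1) :
    blaschkeQuot a m z = blaschkeCoeff a m + (z - 1) * blaschkeQuot a (m + 1) z := by
  cases m with
  | zero =>
    have h1 := one_sub_conj_mul_ne_zero ha hz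
    have h2 := one_sub_conj_ne_zero ha
    have h3 : 1 - z * (starRingEnd ℂ) a ≠ 0 := by rwa [mul_comm]
    simp only [blaschkeCoeff, blaschkeQuot, blaschkeFactor, blaschkeSlope, szegoKernel, mul_one,
      pow_zero]
    field_simp
    ring
  | succ m =>
    have h := szegoKernel_sub ha hz
    simp only [blaschkeCoeff, blaschkeQuot]
    rw [pow_succ]
    linear_combination (blaschkeSlope a * ((starRingEnd ℂ) a / (1 - (starRingEnd ℂ) a)) ^ m) * h

/-- Cauchy's formula: pairing with the Szegő kernel evaluates at `a`. -/
lemma circlePairing_szegoKernel (ha : ‖a‖ < 1) {h : ℂ → ℂ}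
    (hh : DiffContOnCl ℂ h (ball (0 : ℂ) 1)) : circlePairing h (szegoKernel a) = h a := by
  have h1 : DiffContOnCl ℂ h (ball (0 : ℂ) |1|) := by simpa using hh
  rw [← h1.circleAverage_smul_div (w := a) (by simpa using ha)]
  refine circleAverage_congr_of_eqOn fun z hz => ?_
  have hz1 : ‖z‖ = 1 := by simpa using hz
  have hzz : (starRingEnd ℂ) z * z = 1 := by simp [Complex.conj_mul', hz1]
  have hne : z - a ≠ 0 := by
    intro h0
    rw [← sub_eq_zero.mp h0] at ha
    linarith
  have hne2 : 1 - a * (starRingEnd ℂ) z ≠ 0 := by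
    intro h0
    apply hne
    linear_combination z * h0 - (- a) * hzz
  simp only [szegoKernel, map_inv₀, map_sub, map_one, map_mul, Complex.conj_conj, smul_eq_mul,
    sub_zero]
  have : (1 - a * (starRingEnd ℂ) z)⁻¹ = z / (z - a) := by
    field_simp
    linear_combination (a) * hzz
  rw [this, mul_comm]

lemma circlePairing_blaschkeFactor_mul (ha : ‖a‖ < 1) {h : ℂ → ℂ}
    (hh : DiffContOnCl ℂ h (ball (0 : ℂ) 1)) :
    circlePairing (fun z => blaschkeFactor a z * h z) (szegoKernel a) = 0 := by
  rw [circlePairing_szegoKernel ha ((diffContOnCl_blaschkeFactor ha).fun_mul hh)]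
  simp [blaschkeFactor]

lemma sqMean_szegoKernel (ha : ‖a‖ < 1) : sqMean (szegoKernel a) = (1 - ‖a‖ ^ 2)⁻¹ := by
  have hd := diffContOnCl_szegoKernel ha
  have h1 := circlePairing_szegoKernel ha hd
  have hc : ContinuousOn (fun z => szegoKernel a z * (starRingEnd ℂ) (szegoKernel a z))
      (sphere (0 : ℂ) 1) :=
    hd.continuousOn_sphere.mul (Complex.continuous_conj.comp_continuousOn hd.continuousOn_sphere)
  have h2 := Complex.reCLM.circleAverage_comp_comm (circleIntegrable_of_continuousOn hc)
  rw [circlePairing] at h1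
  rw [h1] at h2
  have h3 : (Complex.reCLM (szegoKernel a a)) = (1 - ‖a‖ ^ 2)⁻¹ := by
    have : szegoKernel a a = (((1 - ‖a‖ ^ 2)⁻¹ : ℝ) : ℂ) := by
      simp [szegoKernel, Complex.conj_mul']
    rw [this, Complex.reCLM_apply, Complex.ofReal_re]
  rw [← h3, ← h2, sqMean]
  congr 1
  ext z
  simp only [Function.comp_apply, Complex.mul_conj', Complex.reCLM_apply]
  norm_cast

/-- The summand `(1 - |a|²) / |1 - a|^{2N}`. -/
def carlesonTerm (N : ℕ) (a : ℂ) : ℝ := (1 - ‖a‖ ^ 2) / ‖1 - a‖ ^ (2 * N)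

lemma one_sub_norm_sq_pos (ha : ‖a‖ < 1) : 0 < 1 - ‖a‖ ^ 2 := by
  nlinarith [norm_nonneg a]

lemma norm_one_sub_pos (ha : ‖a‖ < 1) : 0 < ‖1 - a‖ := by
  rw [← norm_one_sub_conj]; exact norm_pos_iff.mpr (one_sub_conj_ne_zero ha)

lemma carlesonTerm_pos (N : ℕ) (ha : ‖a‖ < 1) : 0 < carlesonTerm N a :=
  div_pos (one_sub_norm_sq_pos ha) (pow_pos (norm_one_sub_pos ha) _)

lemma div_norm_one_sub_pow_le (ha : ‖a‖ < 1) {k N : ℕ} (hk : k ≤ 2 * N) :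
    (1 - ‖a‖ ^ 2) / ‖1 - a‖ ^ k ≤ 4 ^ N * carlesonTerm N a := by
  have hp := norm_one_sub_pos ha
  have h2 : ‖1 - a‖ ≤ 2 := by
    have := norm_sub_le (1 : ℂ) a
    rw [norm_one] at this
    linarith
  obtain ⟨d, hd⟩ := Nat.exists_eq_add_of_le hk
  have h4 : ‖1 - a‖ ^ d ≤ 4 ^ N :=
    calc ‖1 - a‖ ^ d ≤ 2 ^ d := by gcongr
      _ ≤ 2 ^ (2 * N) := pow_le_pow_right₀ (by norm_num) (by omega)
      _ = 4 ^ N := by rw [pow_mul]; norm_num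
  have h5 : (1 - ‖a‖ ^ 2) / ‖1 - a‖ ^ k = ‖1 - a‖ ^ d * carlesonTerm N a := by
    rw [carlesonTerm, hd, pow_add]
    field_simp
  rw [h5]
  exact mul_le_mul_of_nonneg_right h4 (carlesonTerm_pos N ha).le

lemma norm_blaschkeSlope (ha : ‖a‖ < 1) (ha0 : a ≠ 0) :
    ‖blaschkeSlope a‖ = (1 - ‖a‖ ^ 2) / ‖1 - a‖ := by
  have h : ‖1 - a * (starRingEnd ℂ) a‖ = 1 - ‖a‖ ^ 2 := by
    rw [Complex.mul_conj']
    have : (1 : ℂ) - (‖a‖ : ℂ) ^ 2 = ((1 - ‖a‖ ^ 2 : ℝ) : ℂ) := by push_cast; rfl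
    rw [this, Complex.norm_real, Real.norm_of_nonneg (one_sub_norm_sq_pos ha).le]
  rw [blaschkeSlope, norm_mul, norm_neg, norm_norm_div_self ha0, norm_div, h, norm_one_sub_conj,
    one_mul]

lemma norm_conj_div_pow_le (ha : ‖a‖ < 1) (m : ℕ) :
    ‖((starRingEnd ℂ) a / (1 - (starRingEnd ℂ) a)) ^ m‖ ≤ 1 / ‖1 - a‖ ^ m := by
  rw [norm_pow, norm_div, norm_one_sub_conj, Complex.norm_conj, div_pow]
  gcongr
  exact pow_le_one₀ (norm_nonneg _) ha.le

lemma norm_blaschkeCoeff_succ_le (ha : ‖a‖ < 1) (ha0 : a ≠ 0) {m N : ℕ} (hm : m + 2 ≤ 2 * N) :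
    ‖blaschkeCoeff a (m + 1)‖ ≤ 4 ^ N * carlesonTerm N a := by
  refine le_trans ?_ (div_norm_one_sub_pow_le ha hm)
  have hp := norm_one_sub_pos ha
  have hq := one_sub_norm_sq_pos ha
  simp only [blaschkeCoeff, blaschkeQuot, szegoKernel, mul_one]
  rw [norm_mul, norm_mul, norm_inv, norm_one_sub_conj, norm_blaschkeSlope ha ha0]
  calc (1 - ‖a‖ ^ 2) / ‖1 - a‖ * ‖((starRingEnd ℂ) a / (1 - (starRingEnd ℂ) a)) ^ m‖ * ‖1 - a‖⁻¹
      ≤ (1 - ‖a‖ ^ 2) / ‖1 - a‖ * (1 / ‖1 - a‖ ^ m) * ‖1 - a‖⁻¹ := by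
        gcongr
        exact norm_conj_div_pow_le ha m
    _ = (1 - ‖a‖ ^ 2) / ‖1 - a‖ ^ (m + 2) := by field_simp; ring

lemma sqMean_blaschkeQuot_succ_le (ha : ‖a‖ < 1) (ha0 : a ≠ 0) {m N : ℕ} (hm : m + 1 ≤ N) :
    sqMean (blaschkeQuot a (m + 1)) ≤ 4 ^ N * carlesonTerm N a := by
  refine le_trans ?_ (div_norm_one_sub_pow_le ha (k := 2 * (m + 1)) (by omega))
  have hp := norm_one_sub_pos ha
  have hq := one_sub_norm_sq_pos ha
  simp only [blaschkeQuot]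
  rw [sqMean_const_mul, norm_mul, sqMean_szegoKernel ha, norm_blaschkeSlope ha ha0]
  calc ((1 - ‖a‖ ^ 2) / ‖1 - a‖ * ‖((starRingEnd ℂ) a / (1 - (starRingEnd ℂ) a)) ^ m‖) ^ 2
        * (1 - ‖a‖ ^ 2)⁻¹
      ≤ ((1 - ‖a‖ ^ 2) / ‖1 - a‖ * (1 / ‖1 - a‖ ^ m)) ^ 2 * (1 - ‖a‖ ^ 2)⁻¹ := by
        gcongr
        exact norm_conj_div_pow_le ha m
    _ = (1 - ‖a‖ ^ 2) / ‖1 - a‖ ^ (2 * (m + 1)) := by field_simp; ring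

end factor

/-- `g m` is the `m`-th Taylor quotient at `1` of the inner function `B`, with Taylor coefficients
`c`, and the positive Taylor quotients are orthogonal to `B H²`. -/
structure IsTaylorQuotient (B : ℂ → ℂ) (g : ℕ → ℂ → ℂ) (c : ℕ → ℂ) : Prop where
  zero : g 0 = B
  eq_add : ∀ m, ∀ z ∈ closedBall (0 : ℂ) 1, g m z = c m + (z - 1) * g (m + 1) z
  diffContOnCl : ∀ m, DiffContOnCl ℂ (g m) (ball 0 1)
  norm_eq_one : ∀ z ∈ sphere (0 : ℂ) 1, ‖B z‖ = 1
  orthogonal : ∀ m, ∀ h : ℂ → ℂ, DiffContOnCl ℂ h (ball 0 1) →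
    circlePairing (fun z => B z * h z) (g (m + 1)) = 0

lemma isTaylorQuotient_one :
    IsTaylorQuotient (fun _ => 1) (fun m _ => if m = 0 then 1 else 0)
      (fun m => if m = 0 then 1 else 0) where
  zero := by simp
  eq_add := by simp
  diffContOnCl _ := diffContOnCl_const
  norm_eq_one := by simp
  orthogonal := by simp [circlePairing, Real.circleAverage_const]

lemma DiffContOnCl.fun_sum {ι : Type*} {s : Finset ι} {G : ι → ℂ → ℂ} {U : Set ℂ}
    (hG : ∀ i ∈ s, DiffContOnCl ℂ (G i) U) : DiffContOnCl ℂ (fun z => ∑ i ∈ s, G i z) U :=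
  ⟨DifferentiableOn.fun_sum fun i hi => (hG i hi).1,
    continuousOn_finsetSum s fun i hi => (hG i hi).2⟩

/-- The Taylor quotients of the product of `B` with a Blaschke factor. -/
def mulQuot (B : ℂ → ℂ) (g : ℕ → ℂ → ℂ) (a : ℂ) (m : ℕ) (z : ℂ) : ℂ :=
  B z * blaschkeQuot a m z + ∑ j ∈ range m, blaschkeCoeff a j * g (m - j) z

namespace IsTaylorQuotient

variable {B : ℂ → ℂ} {g : ℕ → ℂ → ℂ} {c : ℕ → ℂ} {a : ℂ}

lemma diffContOnCl_base (hB : IsTaylorQuotient B g c) : DiffContOnCl ℂ B (ball 0 1) :=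
  hB.zero ▸ hB.diffContOnCl 0

lemma diffContOnCl_mulQuot (hB : IsTaylorQuotient B g c) (ha : ‖a‖ < 1) (m : ℕ) :
    DiffContOnCl ℂ (mulQuot B g a m) (ball 0 1) :=
  (hB.diffContOnCl_base.fun_mul (diffContOnCl_blaschkeQuot ha m)).add
    (DiffContOnCl.fun_sum fun _ _ => diffContOnCl_const.fun_mul (hB.diffContOnCl _))

lemma mul_blaschkeFactor (hB : IsTaylorQuotient B g c) (ha : ‖a‖ < 1) (ha0 : a ≠ 0) :
    IsTaylorQuotient (fun z => B z * blaschkeFactor a z) (mulQuot B g a)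
      (fun m => ∑ j ∈ range (m + 1), blaschkeCoeff a j * c (m - j)) where
  zero := by ext z; simp [mulQuot, blaschkeQuot]
  eq_add m z hz := by
    have h1 : ∑ j ∈ range m, blaschkeCoeff a j * g (m - j) z
        = ∑ j ∈ range m, blaschkeCoeff a j * c (m - j)
          + (z - 1) * ∑ j ∈ range m, blaschkeCoeff a j * g (m + 1 - j) z := by
      rw [Finset.mul_sum, ← Finset.sum_add_distrib]
      refine Finset.sum_congr rfl fun j hj => ?_
      have hj' := Finset.mem_range.mp hj
      rw [hB.eq_add (m - j) z hz, show m + 1 - j = m - j + 1 by omega]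
      ring
    have h2 := hB.eq_add 0 z hz
    rw [hB.zero] at h2
    simp only [mulQuot, Finset.sum_range_succ, Nat.sub_self, Nat.add_sub_cancel_left]
    linear_combination h1 + B z * blaschkeQuot_eq ha ha0 m hz + blaschkeCoeff a m * h2
  diffContOnCl := hB.diffContOnCl_mulQuot ha
  norm_eq_one z hz := by
    rw [norm_mul, hB.norm_eq_one z hz, norm_blaschkeFactor ha ha0 hz, one_mul]
  orthogonal m h hh := by
    have hb := diffContOnCl_blaschkeFactor ha
    have hbh := hb.fun_mul hh
    have hF : ContinuousOn (fun z => B z * (blaschkeFactor a z * h z)) (sphere 0 1) :=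
      (hB.diffContOnCl_base.fun_mul hbh).continuousOn_sphere
    have h1 : circlePairing (fun z => B z * (blaschkeFactor a z * h z))
        (fun z => B z * blaschkeQuot a (m + 1) z) = 0 := by
      rw [circlePairing_mul_mul hB.norm_eq_one]
      simp only [blaschkeQuot]
      rw [circlePairing_const_mul, circlePairing_blaschkeFactor_mul ha hh, mul_zero]
    have h2 : ∀ j ∈ range (m + 1), circlePairing (fun z => B z * (blaschkeFactor a z * h z))
        (fun z => blaschkeCoeff a j * g (m + 1 - j) z) = 0 := by
      intro j hj
      have hj' := Finset.mem_range.mp hj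
      rw [circlePairing_const_mul, show m + 1 - j = m - j + 1 by omega,
        hB.orthogonal (m - j) _ hbh, mul_zero]
    have hc : ∀ j ∈ range (m + 1), ContinuousOn
        (fun z => blaschkeCoeff a j * g (m + 1 - j) z) (sphere 0 1) := fun j _ =>
      (diffContOnCl_const.fun_mul (hB.diffContOnCl _)).continuousOn_sphere
    simp only [mul_assoc]
    change circlePairing _ (fun z => B z * blaschkeQuot a (m + 1) z
      + ∑ j ∈ range (m + 1), blaschkeCoeff a j * g (m + 1 - j) z) = 0
    rw [circlePairing_add hF
      (hB.diffContOnCl_base.fun_mul (diffContOnCl_blaschkeQuot ha _)).continuousOn_sphere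
      (continuousOn_finsetSum _ hc), h1, circlePairing_sum hF hc, Finset.sum_eq_zero h2, add_zero]

lemma sqMean_mulQuot_le (hB : IsTaylorQuotient B g c) (ha : ‖a‖ < 1) (ha0 : a ≠ 0) {N : ℕ}
    {X : ℝ} (hX : ∀ i < N, sqMean (g (i + 1)) ≤ X) {i : ℕ} (hi : i < N) :
    sqMean (mulQuot B g a (i + 1)) ≤ (1 + carlesonTerm N a) *
      (X + 4 ^ N * carlesonTerm N a + (N * 4 ^ N) ^ 2 * carlesonTerm N a * X) := by
  set s := carlesonTerm N a
  have hs : 0 < s := carlesonTerm_pos N ha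
  have hX0 : 0 ≤ X := (sqMean_nonneg _).trans (hX i hi)
  have hq := diffContOnCl_blaschkeQuot ha (i + 1)
  have hu : ContinuousOn (fun z => B z * blaschkeQuot a (i + 1) z) (sphere 0 1) :=
    (hB.diffContOnCl_base.fun_mul hq).continuousOn_sphere
  have hw : ContinuousOn (fun z => blaschkeCoeff a 0 * g (i + 1) z) (sphere 0 1) :=
    (diffContOnCl_const.fun_mul (hB.diffContOnCl _)).continuousOn_sphere
  have hv : ∀ j ∈ range i, ContinuousOn
      (fun z => blaschkeCoeff a (j + 1) * g (i - j) z) (sphere 0 1) := fun j _ =>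
    (diffContOnCl_const.fun_mul (hB.diffContOnCl _)).continuousOn_sphere
  have hsplit : mulQuot B g a (i + 1) = fun z =>
      (B z * blaschkeQuot a (i + 1) z + blaschkeCoeff a 0 * g (i + 1) z)
        + ∑ j ∈ range i, blaschkeCoeff a (j + 1) * g (i - j) z := by
    ext z
    simp only [mulQuot, Finset.sum_range_succ', Nat.add_sub_add_right, Nat.sub_zero]
    ring
  have huw : sqMean (fun z => B z * blaschkeQuot a (i + 1) z + blaschkeCoeff a 0 * g (i + 1) z)
      ≤ X + 4 ^ N * s := by
    rw [sqMean_add_of_circlePairing_eq_zero hu hw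
      (by rw [circlePairing_const_mul, hB.orthogonal i _ hq, mul_zero]),
      sqMean_mul_of_norm_eq_one hB.norm_eq_one, sqMean_const_mul]
    have h1 : ‖blaschkeCoeff a 0‖ = 1 := norm_blaschkeFactor ha ha0 (by simp)
    have h2 := sqMean_blaschkeQuot_succ_le ha ha0 (m := i) (N := N) hi
    rw [h1, one_pow, one_mul]
    linarith [hX i hi]
  have hterm : ∀ j ∈ range i, sqMean (fun z => blaschkeCoeff a (j + 1) * g (i - j) z)
      ≤ (4 ^ N * s) ^ 2 * X := by
    intro j hj
    have hj' := Finset.mem_range.mp hj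
    rw [sqMean_const_mul, show i - j = i - j - 1 + 1 by omega]
    gcongr
    · exact sqMean_nonneg _
    · exact norm_blaschkeCoeff_succ_le ha ha0 (by omega)
    · exact hX _ (by omega)
  have hvN : sqMean (fun z => ∑ j ∈ range i, blaschkeCoeff a (j + 1) * g (i - j) z)
      ≤ (N * (4 ^ N * s)) ^ 2 * X := by
    refine (sqMean_sum_le hv).trans ?_
    have h1 := Finset.sum_le_card_nsmul _ _ _ hterm
    rw [Finset.card_range, nsmul_eq_mul] at h1
    rw [Finset.card_range]
    have hiN : (i : ℝ) ≤ N := by exact_mod_cast hi.le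
    calc _ ≤ (i : ℝ) * (i * ((4 ^ N * s) ^ 2 * X)) := by gcongr
      _ ≤ (N : ℝ) * (N * ((4 ^ N * s) ^ 2 * X)) := by gcongr
      _ = _ := by ring
  rw [hsplit]
  calc _ ≤ (1 + s) * (X + 4 ^ N * s) + (1 + s⁻¹) * ((N * (4 ^ N * s)) ^ 2 * X) := by
        refine (sqMean_add_le (hu.fun_add hw) (continuousOn_finsetSum _ hv) hs).trans ?_
        gcongr
    _ = _ := by field_simp; ring

/-- The Taylor polynomial of `B` of degree less than `N` at `1` leaves the remainder
`(z - 1)^N g_N`. -/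
lemma eq_taylor_add (hB : IsTaylorQuotient B g c) (N : ℕ) {z : ℂ}
    (hz : z ∈ closedBall (0 : ℂ) 1) :
    B z = ∑ m ∈ range N, c m * (z - 1) ^ m + (z - 1) ^ N * g N z := by
  induction N with
  | zero => simp [hB.zero]
  | succ N ih =>
    rw [ih, hB.eq_add N z hz, Finset.sum_range_succ]
    ring

lemma d1N_le (hB : IsTaylorQuotient B g c) (N : ℕ) :
    D1N N B ≤ ENNReal.ofReal (sqMean (g N)) := by
  set q : Polynomial ℂ := ∑ m ∈ range N, Polynomial.C (c m) * (Polynomial.X - Polynomial.C 1) ^ m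
    with hq
  have hdeg : q.degree < (N : ℕ) := by
    refine (Polynomial.degree_sum_le _ _).trans_lt ((Finset.sup_lt_iff (by simp)).mpr fun m hm => ?_)
    refine (Polynomial.degree_mul_le _ _).trans_lt ?_
    rw [Polynomial.degree_pow, Polynomial.degree_X_sub_C]
    refine (add_le_add_left Polynomial.degree_C_le _).trans_lt ?_
    simpa using hm
  have heval : ∀ z, q.eval z = ∑ m ∈ range N, c m * (z - 1) ^ m := by
    intro z
    simp [hq, Polynomial.eval_finsetSum]
  have heq : ∀ z ∈ ball (0 : ℂ) 1, (B z - q.eval z) / (z - 1) ^ N = g N z := by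
    intro z hz
    have hz1 : z - 1 ≠ 0 := by
      intro h
      rw [sub_eq_zero.mp h] at hz
      simp at hz
    rw [heval, hB.eq_taylor_add N (ball_subset_closedBall hz), add_sub_cancel_left,
      mul_div_cancel_left₀ _ (pow_ne_zero _ hz1)]
  have hmean : ∀ r : ℝ, 0 < r → r < 1 →
      (1 / (2 * Real.pi)) * ∫ t in (0 : ℝ)..(2 * Real.pi),
        ‖(fun z => (B z - q.eval z) / (z - 1) ^ N)
          ((r : ℂ) * Complex.exp ((t : ℂ) * Complex.I))‖ ^ 2 ≤ sqMean (g N) := by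
    intro r hr0 hr
    refine le_trans (le_of_eq ?_) (circleMean_le_sqMean (hB.diffContOnCl N) hr0 hr)
    congr 2
    ext t
    rw [← heq]
    simpa [abs_of_pos hr0, Complex.norm_exp_ofReal_mul_I] using hr
  have hmem : MemHardy2 fun z => (B z - q.eval z) / (z - 1) ^ N :=
    ⟨(hB.diffContOnCl N).1.congr heq, _, hmean⟩
  refine (iInf₂_le q ⟨hdeg, hmem⟩).trans (ENNReal.ofReal_le_ofReal ?_)
  refine csSup_le ⟨_, 1 / 2, by norm_num, by norm_num, rfl⟩ ?_
  rintro _ ⟨r, hr0, hr, rfl⟩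
  exact hmean r hr0 hr

end IsTaylorQuotient

lemma exists_isTaylorQuotient_prod (N : ℕ) (lam : ℕ → ℂ) (hlam : ∀ k, ‖lam k‖ < 1 ∧ lam k ≠ 0)
    (n : ℕ) :
    ∃ g c, IsTaylorQuotient (fun z => ∏ k ∈ range n, blaschkeFactor (lam k) z) g c ∧
      ∀ i < N, sqMean (g (i + 1)) ≤ 4 ^ N * (∑ k ∈ range n, carlesonTerm N (lam k)) *
        Real.exp ((1 + (N * 4 ^ N) ^ 2) * ∑ k ∈ range n, carlesonTerm N (lam k)) := by
  induction n with
  | zero =>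
    refine ⟨_, _, by simpa using isTaylorQuotient_one, fun i _ => ?_⟩
    simp [sqMean, Real.circleAverage_const]
  | succ n ih =>
    obtain ⟨g, c, hB, hX⟩ := ih
    obtain ⟨ha, ha0⟩ := hlam n
    refine ⟨_, _, by simpa only [Finset.prod_range_succ] using hB.mul_blaschkeFactor ha ha0,
      fun i hi => (hB.sqMean_mulQuot_le ha ha0 hX hi).trans ?_⟩
    rw [Finset.sum_range_succ]
    set s := carlesonTerm N (lam n)
    set S := ∑ k ∈ range n, carlesonTerm N (lam k)
    set M : ℝ := (N * 4 ^ N) ^ 2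
    set K : ℝ := 4 ^ N
    have hs : 0 < s := carlesonTerm_pos N ha
    have hS : 0 ≤ S := Finset.sum_nonneg fun k _ => (carlesonTerm_pos N (hlam k).1).le
    have hM : 0 ≤ M := sq_nonneg _
    have hK : 0 ≤ K := by positivity
    set P := Real.exp ((1 + M) * S)
    have hP : 1 ≤ P := Real.one_le_exp (by positivity)
    have hexp : Real.exp ((1 + M) * (S + s)) = P * (Real.exp s * Real.exp (M * s)) := by
      rw [← Real.exp_add, ← Real.exp_add]; ring_nf
    have h1 : 1 + s ≤ Real.exp s := by linarith [Real.add_one_le_exp s]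
    have h2 : 1 + M * s ≤ Real.exp (M * s) := by linarith [Real.add_one_le_exp (M * s)]
    calc (1 + s) * (K * S * P + K * s + M * s * (K * S * P))
        ≤ (1 + s) * (K * S * P + K * s * P + M * s * (K * (S + s) * P)) := by
          have h3 : K * s ≤ K * s * P := le_mul_of_one_le_right (by positivity) hP
          have h4 : S ≤ S + s := by linarith
          gcongr
      _ = K * (S + s) * P * ((1 + s) * (1 + M * s)) := by ring
      _ ≤ K * (S + s) * P * (Real.exp s * Real.exp (M * s)) := by gcongr
      _ = _ := by rw [hexp]; ring

/-- **Corollary.** For every `N ≥ 1` and `A > 0` there is `C = C(N,A) > 0` such that: if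
`(λ k)` is a sequence in `𝔻 ∖ {0}` with `∑_k (1-|λ k|²)/|1-λ k|^{2N} ≤ A`, then for every `n`
the finite Blaschke product `B_n(z) = ∏_{k<n} (|λ k|/λ k)·(λ k - z)/(1 - conj(λ k) z)`
satisfies `D₁^N(B_n) ≤ C · ∑_{k<n} (1-|λ k|²)/|1-λ k|^{2N}`. -/
theorem statement8 (N : ℕ) (hN : 1 ≤ N) (A : ℝ) (hA : 0 < A) :
    ∃ C : ℝ, 0 < C ∧
      ∀ (lam : ℕ → ℂ), (∀ k, ‖lam k‖ < 1 ∧ lam k ≠ 0) →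
        (∀ F : Finset ℕ, ∑ k ∈ F, (1 - ‖lam k‖ ^ 2) / ‖1 - lam k‖ ^ (2 * N) ≤ A) →
        ∀ n : ℕ,
          D1N N (fun z => ∏ k ∈ range n,
              ((‖lam k‖ : ℂ) / lam k) * ((lam k - z) / (1 - (starRingEnd ℂ) (lam k) * z))) ≤
            ENNReal.ofReal (C * ∑ k ∈ range n, (1 - ‖lam k‖ ^ 2) / ‖1 - lam k‖ ^ (2 * N)) := by

  set L : ℝ := 1 + (N * 4 ^ N) ^ 2
  refine ⟨4 ^ N * Real.exp (L * A), by positivity, fun lam hlam hsum n => ?_⟩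
  obtain ⟨g, c, hB, hg⟩ := exists_isTaylorQuotient_prod N lam hlam n
  refine (hB.d1N_le N).trans (ENNReal.ofReal_le_ofReal ?_)
  have h := hg (N - 1) (by omega)
  rw [Nat.sub_add_cancel hN] at h
  refine h.trans ?_
  have hS : 0 ≤ ∑ k ∈ range n, carlesonTerm N (lam k) :=
    Finset.sum_nonneg fun k _ => (carlesonTerm_pos N (hlam k).1).le
  have hA' : ∑ k ∈ range n, carlesonTerm N (lam k) ≤ A := hsum (range n)
  calc _ ≤ 4 ^ N * (∑ k ∈ range n, carlesonTerm N (lam k)) * Real.exp (L * A) := by gcongr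
    _ = 4 ^ N * Real.exp (L * A) * ∑ k ∈ range n, carlesonTerm N (lam k) := by ring
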